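/- Suppose ℓ is twice continuously differentiable with ℓ'' > 0, D_c ≠ ∅, and the regularization path converges in direction: lim_{B→∞} w̄(B)/B = ū ∈ S^⊥. Then γ̄ := min_{(x_i,y_i)∈D_c} y_i⟨ū, x_i⟩ satisfies γ̄ ≥ γ̂²/(8|D_c|) > 0, where γ̂ := max{ min_{(x_i,y_i)∈D_c} y_i⟨u, x_i⟩ : u ∈ S^⊥, ‖u‖ = 1 } is the maximum margin of D_c within S^⊥. -/

import Mathlib

open Filter RealInnerProductSpace
open scoped Classical


theorem aux_tangent (ℓ : ℝ → ℝ) (hconv : ConvexOn ℝ Set.univ ℓ) (hd : Differentiable ℝ ℓ)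
    (t s : ℝ) : ℓ t + deriv ℓ t * (s - t) ≤ ℓ s := by
  rcases lt_trichotomy t s with h | h | h
  · have := hconv.deriv_le_slope (Set.mem_univ t) (Set.mem_univ s) h (hd t)
    rw [slope_def_field, le_div_iff₀ (by linarith)] at this
    linarith
  · subst h; simp
  · have := hconv.slope_le_deriv (Set.mem_univ s) (Set.mem_univ t) h (hd t)
    rw [slope_def_field, div_le_iff₀ (by linarith)] at this
    linarith

theorem aux_deriv_mono (ℓ : ℝ → ℝ) (hconv : ConvexOn ℝ Set.univ ℓ) (hd : Differentiable ℝ ℓ)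
    (t s : ℝ) (h : t ≤ s) : deriv ℓ t ≤ deriv ℓ s := by
  rcases h.eq_or_lt with h | h
  · rw [h]
  · have h1 := aux_tangent ℓ hconv hd t s
    have h2 := aux_tangent ℓ hconv hd s t
    by_contra h3
    push Not at h3
    nlinarith [mul_pos (sub_pos.2 h) (sub_pos.2 h3)]

theorem aux_deriv_neg (ℓ : ℝ → ℝ) (hconv : ConvexOn ℝ Set.univ ℓ) (hd : Differentiable ℝ ℓ)
    (hanti : StrictAnti ℓ) (t : ℝ) : deriv ℓ t < 0 := by
  have h1 := aux_tangent ℓ hconv hd t (t + 1)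
  have h2 := hanti (show t < t + 1 by linarith)
  linarith

theorem aux_decay (ℓ : ℝ → ℝ) (hconv : ConvexOn ℝ Set.univ ℓ) (hd : Differentiable ℝ ℓ)
    (hanti : StrictAnti ℓ) (hlim0 : Tendsto ℓ atTop (nhds 0)) (ε s₀ : ℝ) (hε : 0 < ε)
    (hε1 : ε < 1) (hs₀ : 0 < s₀)
    (h : ∀ s, s₀ ≤ s → ε * (-deriv ℓ (ε * s)) ≤ -deriv ℓ s) : False := by
  have hneg := aux_deriv_neg ℓ hconv hd hanti
  have hup : ∀ s, s * (-deriv ℓ s) ≤ 2 * (ℓ (s / 2) - ℓ s) := by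
    intro s
    have := aux_tangent ℓ hconv hd s (s / 2)
    linarith
  have hk : ∀ k : ℕ, s₀ ≤ s₀ / ε ^ k ∧
      s₀ * (-deriv ℓ s₀) ≤ (s₀ / ε ^ k) * (-deriv ℓ (s₀ / ε ^ k)) := by
    intro k
    induction k with
    | zero => simp
    | succ k ih =>
      have hge : s₀ ≤ s₀ / ε ^ (k + 1) := by
        rw [le_div_iff₀ (by positivity)]
        have : ε ^ (k + 1) ≤ 1 := pow_le_one₀ hε.le hε1.le
        nlinarith
      refine ⟨hge, ih.2.trans ?_⟩
      have h1 := h _ hge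
      have h2 : ε * (s₀ / ε ^ (k + 1)) = s₀ / ε ^ k := by
        rw [pow_succ]; field_simp
      rw [h2] at h1
      have h3 := mul_le_mul_of_nonneg_left h1 (hs₀.le.trans hge)
      refine le_trans (le_of_eq ?_) h3
      rw [← h2]; ring
  have htop : Tendsto (fun k : ℕ => s₀ / ε ^ k) atTop atTop := by
    have := tendsto_pow_atTop_atTop_of_one_lt (one_lt_inv_iff₀.2 ⟨hε, hε1⟩)
    have := this.const_mul_atTop hs₀
    refine this.congr fun k => ?_
    rw [inv_pow, div_eq_mul_inv]
  have hl : Tendsto (fun s : ℝ => 2 * (ℓ (s / 2) - ℓ s)) atTop (nhds 0) := by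
    have h1 : Tendsto (fun s : ℝ => s / 2) atTop atTop :=
      tendsto_id.atTop_div_const (by norm_num)
    have := ((hlim0.comp h1).sub hlim0).const_mul 2
    simpa using this
  have hle := ge_of_tendsto (hl.comp htop)
    (Eventually.of_forall fun k => (hk k).2.trans (hup _))
  have := mul_pos hs₀ (neg_pos.2 (hneg s₀))
  linarith

theorem aux_variational {E : Type*} [NormedAddCommGroup E] [InnerProductSpace ℝ E] {n : ℕ}
    (z : Fin n → E) (ℓ : ℝ → ℝ) (hd : Differentiable ℝ ℓ) (w v : E) (B : ℝ)
    (hw : ‖w‖ ≤ B) (hv : ‖v‖ ≤ B)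
    (hmin : ∀ v, ‖v‖ ≤ B → ∑ i, ℓ ⟪w, z i⟫ ≤ ∑ i, ℓ ⟪v, z i⟫) :
    0 ≤ ∑ i, deriv ℓ ⟪w, z i⟫ * (⟪v, z i⟫ - ⟪w, z i⟫) := by
  set f : ℝ → ℝ := fun t => ∑ i, ℓ (⟪w, z i⟫ + t * (⟪v, z i⟫ - ⟪w, z i⟫)) with hf
  have hder : HasDerivAt f (∑ i, deriv ℓ ⟪w, z i⟫ * (⟪v, z i⟫ - ⟪w, z i⟫)) 0 := by
    refine HasDerivAt.fun_sum fun i _ => ?_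
    have h1 : HasDerivAt (fun t : ℝ => ⟪w, z i⟫ + t * (⟪v, z i⟫ - ⟪w, z i⟫))
        (⟪v, z i⟫ - ⟪w, z i⟫) 0 := by
      simpa using ((hasDerivAt_id (0 : ℝ)).mul_const (⟪v, z i⟫ - ⟪w, z i⟫)).const_add ⟪w, z i⟫
    have h2 : HasDerivAt ℓ (deriv ℓ ⟪w, z i⟫) (⟪w, z i⟫ + 0 * (⟪v, z i⟫ - ⟪w, z i⟫)) := by
      simpa using (hd ⟪w, z i⟫).hasDerivAt
    exact h2.comp 0 h1
  have hslope := hder.tendsto_slope_zero_right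
  refine ge_of_tendsto hslope ?_
  have : Set.Ioc (0 : ℝ) 1 ∈ nhdsWithin (0 : ℝ) (Set.Ioi 0) := Ioc_mem_nhdsGT (by norm_num)
  filter_upwards [this] with t ht
  have hle : f 0 ≤ f t := by
    have h3 := hmin ((1 - t) • w + t • v) (by
      refine (norm_add_le _ _).trans ?_
      rw [norm_smul, norm_smul, Real.norm_of_nonneg ht.1.le,
        Real.norm_of_nonneg (by linarith [ht.2])]
      nlinarith [ht.1, ht.2])
    simp only [hf, zero_mul, add_zero]
    refine h3.trans (le_of_eq (Finset.sum_congr rfl fun i _ => ?_))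
    congr 1
    rw [inner_add_left, real_inner_smul_left, real_inner_smul_left]; ring
  rw [zero_add, smul_eq_mul]
  exact mul_nonneg (inv_nonneg.2 ht.1.le) (by linarith)

theorem aux_select {ι : Type*} [Fintype ι] (a p : ι → ℝ) (ρ γ : ℝ) (j : ι)
    (ha : ∀ i, 0 < a i) (hp : ∀ i, p i ≤ ρ) (hρ : 0 < ρ) (hγ : 0 < γ)
    (h : ρ * γ * ∑ i, a i ≤ ∑ i, a i * p i) :
    ∃ i, ρ * γ / 2 ≤ p i ∧ γ / (2 * (Nat.card ι : ℝ)) * a j ≤ a i := by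
  by_contra hcon
  push Not at hcon
  have : Nonempty ι := ⟨j⟩
  have hN : (0 : ℝ) < Nat.card ι := by exact_mod_cast Nat.card_pos
  have key : ∀ i, a i * p i < ρ * γ / 2 * (a i + a j / Nat.card ι) := by
    intro i
    have hj : 0 < a j / Nat.card ι := div_pos (ha j) hN
    have hrg : 0 < ρ * γ := mul_pos hρ hγ
    by_cases hi : ρ * γ / 2 ≤ p i
    · have h1 := hcon i hi
      have h2 : γ / (2 * (Nat.card ι : ℝ)) * a j = γ / 2 * (a j / Nat.card ι) := by field_simp
      rw [h2] at h1
      have h3 := mul_le_mul_of_nonneg_left (hp i) (ha i).le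
      have h4 := mul_lt_mul_of_pos_right h1 hρ
      have h5 := mul_pos hrg (ha i)
      nlinarith
    · push Not at hi
      have h3 := mul_lt_mul_of_pos_left hi (ha i)
      have h5 := mul_pos hrg hj
      nlinarith
  have hs : ∑ i, a i * p i < ∑ i, ρ * γ / 2 * (a i + a j / Nat.card ι) :=
    Finset.sum_lt_sum_of_nonempty Finset.univ_nonempty fun i _ => key i
  rw [← Finset.mul_sum, Finset.sum_add_distrib, Finset.sum_const, Finset.card_univ,
    ← Nat.card_eq_fintype_card, nsmul_eq_mul, mul_div_cancel₀ _ hN.ne'] at hs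
  have hj : a j ≤ ∑ i, a i := Finset.single_le_sum (fun i _ => (ha i).le) (Finset.mem_univ j)
  have := mul_le_mul_of_nonneg_left hj (mul_pos hρ hγ).le
  linarith

theorem aux_gamma_pos {E : Type*} [NormedAddCommGroup E] [InnerProductSpace ℝ E] {n : ℕ}
    (z : Fin n → E) (InC : Fin n → Prop)
    (hInC : ∀ i, InC i ↔ ∃ u : E, ‖u‖ = 1 ∧ 0 < ⟪u, z i⟫ ∧ ∀ j, 0 ≤ ⟪u, z j⟫)
    (hDc : ∃ i, InC i) :
    ∃ v : E, ‖v‖ = 1 ∧ (∀ i, InC i → 0 < ⟪v, z i⟫) ∧ ∀ i, ¬ InC i → ⟪v, z i⟫ = 0 := by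
  choose u hu using fun i : {i // InC i} => (hInC i.1).1 i.2
  set U : E := ∑ i, u i with hU
  have hpos : ∀ i, InC i → 0 < ⟪U, z i⟫ := by
    intro i hi
    rw [hU, sum_inner]
    exact Finset.sum_pos' (fun k _ => (hu k).2.2 i) ⟨⟨i, hi⟩, Finset.mem_univ _, (hu ⟨i, hi⟩).2.1⟩
  have hzero : ∀ i, ¬ InC i → ⟪U, z i⟫ = 0 := by
    intro i hi
    rw [hU, sum_inner]
    refine Finset.sum_eq_zero fun k _ => ?_
    by_contra hne
    exact hi ((hInC i).2 ⟨u k, (hu k).1, lt_of_le_of_ne ((hu k).2.2 i) (Ne.symm hne), (hu k).2.2⟩)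
  have hU0 : U ≠ 0 := by
    obtain ⟨i, hi⟩ := hDc
    intro h0
    have := hpos i hi
    simp [h0] at this
  refine ⟨‖U‖⁻¹ • U, norm_smul_inv_norm hU0, fun i hi => ?_, fun i hi => ?_⟩
  · rw [real_inner_smul_left]
    exact mul_pos (inv_pos.2 (norm_pos_iff.2 hU0)) (hpos i hi)
  · rw [real_inner_smul_left, hzero i hi, mul_zero]

theorem aux_core {E : Type*} [NormedAddCommGroup E] [InnerProductSpace ℝ E]
    [FiniteDimensional ℝ E] {n : ℕ}
    (z : Fin n → E) (hz : ∀ i, ‖z i‖ ≤ 1) (ℓ : ℝ → ℝ)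
    (hconv : ConvexOn ℝ Set.univ ℓ) (hanti : StrictAnti ℓ) (hlim0 : Tendsto ℓ atTop (nhds 0))
    (hd : Differentiable ℝ ℓ) (InC : Fin n → Prop) (S : Submodule ℝ E)
    (hS : ∀ i, ¬ InC i → z i ∈ S) (wbar : ℝ → E)
    (hwbar : ∀ B : ℝ, 0 ≤ B → ‖wbar B‖ ≤ B ∧
      ∀ v, ‖v‖ ≤ B → ∑ i, ℓ ⟪wbar B, z i⟫ ≤ ∑ i, ℓ ⟪v, z i⟫)
    (ubar : E) (hubar : ‖ubar‖ = 1) (hubarS : ubar ∈ Sᗮ)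
    (hlim : Tendsto (fun B : ℝ => B⁻¹ • wbar B) atTop (nhds ubar))
    (γ : ℝ) (hγ : 0 < γ) (hγ1 : γ ≤ 1) (û : E) (hû : ‖û‖ = 1) (hûS : û ∈ Sᗮ)
    (hûγ : ∀ i, InC i → γ ≤ ⟪û, z i⟫) (j : Fin n) (hj : InC j) :
    γ ^ 2 / (8 * (Nat.card {i : Fin n // InC i} : ℝ)) ≤ ⟪ubar, z j⟫ := by
  by_contra hcon
  push Not at hcon
  have : Nonempty {i : Fin n // InC i} := ⟨⟨j, hj⟩⟩
  set N : ℝ := (Nat.card {i : Fin n // InC i} : ℝ) with hNdef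
  have hN : 1 ≤ N := by
    rw [hNdef]; exact_mod_cast Nat.card_pos (α := {i : Fin n // InC i})
  have hneg := aux_deriv_neg ℓ hconv hd hanti
  set P : E →L[ℝ] E := Sᗮ.starProjection with hP
  have hPu : P ubar = ubar := Submodule.starProjection_eq_self_iff.2 hubarS
  have hlimP : Tendsto (fun B : ℝ => ‖B⁻¹ • P (wbar B)‖) atTop (nhds 1) := by
    have := ((P.continuous.tendsto ubar).comp hlim).norm
    simpa [hPu, hubar, Function.comp_def] using this
  have hlimD : Tendsto (fun B : ℝ => ‖B⁻¹ • (wbar B - P (wbar B))‖) atTop (nhds 0) := by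
    have := (hlim.sub ((P.continuous.tendsto ubar).comp hlim)).norm
    simpa [hPu, Function.comp_def, smul_sub] using this
  have hlimj : Tendsto (fun B : ℝ => B⁻¹ * ⟪wbar B, z j⟫) atTop (nhds ⟪ubar, z j⟫) := by
    have := Tendsto.inner (𝕜 := ℝ) hlim (tendsto_const_nhds (x := z j))
    simpa [real_inner_smul_left] using this
  have hev : ∀ᶠ B : ℝ in atTop,
      γ / (2 * N) * (-deriv ℓ (γ ^ 2 / (8 * N) * B)) ≤ -deriv ℓ (γ / 4 * B) := by
    filter_upwards [eventually_gt_atTop 0, hlimP.eventually_const_lt (show (3/4 : ℝ) < 1 by norm_num),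
      hlimD.eventually_lt_const (show (0 : ℝ) < γ / 8 by linarith),
      hlimj.eventually_lt_const hcon] with B hB h1 h2 h3
    obtain ⟨hw, hmin⟩ := hwbar B hB.le
    set w := wbar B with hwdef
    rw [norm_smul, norm_inv, Real.norm_of_nonneg hB.le, inv_mul_eq_div] at h1 h2
    rw [lt_div_iff₀ hB] at h1
    rw [div_lt_iff₀ hB] at h2
    rw [inv_mul_eq_div, div_lt_iff₀ hB] at h3
    have hρ : 0 < ‖P w‖ := by nlinarith
    have hPS : P w ∈ Sᗮ := by rw [hP]; exact Submodule.starProjection_apply_mem _ _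
    have hQS : ∀ q ∈ Sᗮ, ⟪w - P w, q⟫ = 0 := fun q hq => by
      rw [hP]; exact Submodule.starProjection_inner_eq_zero _ _ hq
    have hPle : ‖P w‖ ≤ B := by
      refine le_trans ?_ hw
      have hh := norm_add_sq_real (w - P w) (P w)
      rw [hQS _ hPS, sub_add_cancel] at hh
      exact abs_le_of_sq_le_sq' (by nlinarith [sq_nonneg ‖w - P w‖]) (norm_nonneg _) |>.2
    set v : E := (w - P w) + ‖P w‖ • û with hv
    have hvn : ‖v‖ ≤ B := by
      have e1 := norm_add_sq_real (w - P w) (P w)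
      rw [hQS _ hPS, sub_add_cancel] at e1
      have e2 := norm_add_sq_real (w - P w) (‖P w‖ • û)
      rw [hQS _ (Sᗮ.smul_mem _ hûS), norm_smul, hû, norm_norm, mul_one] at e2
      have : ‖v‖ ^ 2 ≤ ‖w‖ ^ 2 := by rw [hv, e1, e2]
      exact (abs_le_of_sq_le_sq' this (norm_nonneg _)).2.trans hw
    have hvar := aux_variational z ℓ hd w v B hw hvn hmin
    have hdiff : ∀ i, ⟪v, z i⟫ - ⟪w, z i⟫ = ‖P w‖ * ⟪û, z i⟫ - ⟪P w, z i⟫ := by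
      intro i
      rw [hv, inner_add_left, inner_sub_left, real_inner_smul_left]; ring
    have hsplit : ∑ i : {i : Fin n // InC i},
        deriv ℓ ⟪w, z i⟫ * (⟪v, z i⟫ - ⟪w, z i⟫) =
        ∑ i, deriv ℓ ⟪w, z i⟫ * (⟪v, z i⟫ - ⟪w, z i⟫) := by
      rw [← Finset.sum_subtype (Finset.univ.filter InC) (fun i => by simp)
        (fun i => deriv ℓ ⟪w, z i⟫ * (⟪v, z i⟫ - ⟪w, z i⟫))]
      refine Finset.sum_subset (Finset.subset_univ _) fun i _ hi => ?_
      have hi' : ¬ InC i := by simpa using hi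
      rw [hdiff, Submodule.inner_left_of_mem_orthogonal (hS i hi') hûS,
        Submodule.inner_left_of_mem_orthogonal (hS i hi') hPS]
      simp
    rw [← hsplit] at hvar
    obtain ⟨i, hi1, hi2⟩ := aux_select (ι := {i : Fin n // InC i})
      (fun i => -deriv ℓ ⟪w, z i⟫) (fun i => ⟪P w, z i⟫) ‖P w‖ γ ⟨j, hj⟩
      (fun i => neg_pos.2 (hneg _))
      (fun i => (real_inner_le_norm _ _).trans (by nlinarith [hz i.1, norm_nonneg (z i.1)]))
      hρ hγ (by
        rw [Finset.mul_sum, ← sub_nonneg, ← Finset.sum_sub_distrib]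
        refine hvar.trans (Finset.sum_le_sum fun i _ => ?_)
        rw [hdiff]
        have := mul_le_mul_of_nonneg_left (hûγ i.1 i.2) hρ.le
        have := mul_le_mul_of_nonneg_left this (neg_pos.2 (hneg ⟪w, z i⟫)).le
        linarith)
    have hi3 : γ / 4 * B ≤ ⟪w, z i.1⟫ := by
      have e1 : |⟪w - P w, z i.1⟫| ≤ ‖w - P w‖ :=
        (abs_real_inner_le_norm _ _).trans
          (by nlinarith [hz i.1, norm_nonneg (z i.1), norm_nonneg (w - P w)])
      have e2 := (abs_le.1 e1).1
      rw [inner_sub_left] at e2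
      nlinarith
    have f1 := aux_deriv_mono ℓ hconv hd _ _ hi3
    have f2 := aux_deriv_mono ℓ hconv hd _ _ h3.le
    have hc : 0 ≤ γ / (2 * N) := by positivity
    have f3 := mul_le_mul_of_nonneg_left (neg_le_neg f2) hc
    simp only at hi2
    linarith
  obtain ⟨B₀, hB₀⟩ := eventually_atTop.1 hev
  have hN0 : 0 < N := by linarith
  refine aux_decay ℓ hconv hd hanti hlim0 (γ / (2 * N)) (γ / 4 * max B₀ 1) (by positivity)
    (by rw [div_lt_one (by positivity)]; linarith) (by positivity) fun s hs => ?_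
  have h4 := hB₀ (4 / γ * s) (by
    rw [div_mul_eq_mul_div, le_div_iff₀ hγ]
    nlinarith [le_max_left B₀ 1])
  have g1 : γ / 4 * (4 / γ * s) = s := by field_simp
  have g2 : γ ^ 2 / (8 * N) * (4 / γ * s) = γ / (2 * N) * s := by field_simp; ring
  rwa [g1, g2] at h4

/-- For a twice continuously differentiable loss with
`ℓ'' > 0`, nonempty `D_c`, and a regularization path converging in direction to
`ū ∈ S^⊥`, the margin `γ̄ = min_{i ∈ D_c} yᵢ⟨ū, xᵢ⟩` satisfies
`γ̄ ≥ γ̂²/(8|D_c|) > 0`, where `γ̂` is the maximum margin of `D_c` within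
`S^⊥`. -/
theorem general_data_margin_lower_bound
    {d n : ℕ} (hn : 0 < n)
    (x : Fin n → EuclideanSpace ℝ (Fin d)) (y : Fin n → ℝ)
    (hx : ∀ i, ‖x i‖ ≤ 1) (hy : ∀ i, y i = 1 ∨ y i = -1)
    (ℓ : ℝ → ℝ)
    (hconv : ConvexOn ℝ Set.univ ℓ)
    (hanti : StrictAnti ℓ)
    (hlim0 : Tendsto ℓ atTop (nhds 0))
    (hC2 : ContDiff ℝ 2 ℓ)
    (hℓ'' : ∀ z : ℝ, 0 < deriv (deriv ℓ) z)
    (R : EuclideanSpace ℝ (Fin d) → ℝ)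
    (hR : R = fun w => (1 / (n : ℝ)) * ∑ i, ℓ (y i * ⟪w, x i⟫))
    (InC : Fin n → Prop)
    (hInC : ∀ i, InC i ↔ ∃ u : EuclideanSpace ℝ (Fin d), ‖u‖ = 1 ∧
      0 < y i * ⟪u, x i⟫ ∧ ∀ j, 0 ≤ y j * ⟪u, x j⟫)
    (hDc : ∃ i, InC i)
    (S : Submodule ℝ (EuclideanSpace ℝ (Fin d)))
    (hS : S = Submodule.span ℝ {v | ∃ i, ¬ InC i ∧ x i = v})
    (wbar : ℝ → EuclideanSpace ℝ (Fin d))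
    (hwbar : ∀ B : ℝ, 0 ≤ B → ‖wbar B‖ ≤ B ∧ ∀ v, ‖v‖ ≤ B → R (wbar B) ≤ R v)
    (ubar : EuclideanSpace ℝ (Fin d)) (hubar : ‖ubar‖ = 1) (hubarS : ubar ∈ Sᗮ)
    (hlim : Tendsto (fun B : ℝ => B⁻¹ • wbar B) atTop (nhds ubar))
    (γhat : ℝ)
    (hγhat : IsGreatest
      {g : ℝ | ∃ v : EuclideanSpace ℝ (Fin d), v ∈ Sᗮ ∧ ‖v‖ = 1 ∧
        g = ⨅ i : {i : Fin n // InC i}, y i.1 * ⟪v, x i.1⟫} γhat) :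
    γhat ^ 2 / (8 * (Nat.card {i : Fin n // InC i} : ℝ)) ≤
      (⨅ i : {i : Fin n // InC i}, y i.1 * ⟪ubar, x i.1⟫) ∧
    0 < γhat ^ 2 / (8 * (Nat.card {i : Fin n // InC i} : ℝ)) := by
  set z : Fin n → EuclideanSpace ℝ (Fin d) := fun i => y i • x i with hzdef
  have hyz : ∀ w i, y i * ⟪w, x i⟫ = ⟪w, z i⟫ := fun w i => by
    rw [hzdef]; exact (real_inner_smul_right _ _ _).symm
  have hz : ∀ i, ‖z i‖ ≤ 1 := fun i => by
    have : ‖y i‖ = 1 := by rcases hy i with h | h <;> simp [h]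
    rw [hzdef]; simp only
    rw [norm_smul, this, one_mul]; exact hx i
  simp only [hyz] at hR hInC hγhat ⊢
  have hn' : (0 : ℝ) < 1 / (n : ℝ) := by positivity
  obtain ⟨j₀, hj₀⟩ := id hDc
  have : Nonempty {i : Fin n // InC i} := ⟨⟨j₀, hj₀⟩⟩
  have hbdd : ∀ v : EuclideanSpace ℝ (Fin d),
      BddBelow (Set.range fun i : {i : Fin n // InC i} => ⟪v, z i.1⟫) :=
    fun v => (Set.finite_range _).bddBelow
  have hγpos : 0 < γhat := by
    obtain ⟨v, hv1, hv2, hv3⟩ := aux_gamma_pos z InC hInC hDc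
    obtain ⟨i, hi⟩ := exists_eq_ciInf_of_finite (f := fun i : {i : Fin n // InC i} => ⟪v, z i.1⟫)
    have hle := hγhat.2 ⟨v, ?_, hv1, rfl⟩
    · rw [← hi] at hle
      exact (hv2 i.1 i.2).trans_le hle
    · rw [hS, Submodule.mem_orthogonal]
      intro q hq
      induction hq using Submodule.span_induction with
      | mem q hq =>
        obtain ⟨i, hi, rfl⟩ := hq
        have h0 := hv3 i hi
        rw [← hyz] at h0
        rw [real_inner_comm]
        rcases hy i with h | h <;> simpa [h] using h0
      | zero => simp
      | add a b _ _ ha hb => rw [inner_add_left, ha, hb, add_zero]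
      | smul c a _ ha => rw [real_inner_smul_left, ha, mul_zero]
  obtain ⟨û, hûS, hû, hûγ⟩ := hγhat.1
  have hûγ' : ∀ i, InC i → γhat ≤ ⟪û, z i⟫ := fun i hi => by
    rw [hûγ]; exact ciInf_le (hbdd û) ⟨i, hi⟩
  have hγ1 : γhat ≤ 1 := (hûγ' j₀ hj₀).trans ((real_inner_le_norm _ _).trans (by
    rw [hû, one_mul]; exact hz j₀))
  have hN : (0 : ℝ) < Nat.card {i : Fin n // InC i} := by exact_mod_cast Nat.card_pos
  refine ⟨le_ciInf fun j => ?_, by positivity⟩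
  refine aux_core z hz ℓ hconv hanti hlim0 (hC2.differentiable (by norm_num)) InC S ?_ wbar ?_ ubar
    hubar hubarS hlim γhat hγpos hγ1 û hû hûS hûγ' j.1 j.2
  · intro i hi
    rw [hS]
    exact Submodule.smul_mem _ _ (Submodule.subset_span ⟨i, hi, rfl⟩)
  · intro B hB
    refine ⟨(hwbar B hB).1, fun v hv => ?_⟩
    have := (hwbar B hB).2 v hv
    simp only [hR] at this
    exact le_of_mul_le_mul_left this hn'
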